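/- The polynomial g = g₆ + z⁷ ∈ ℂ[x,y,z] has an isolated critical point at the origin, and its Milnor number is μ(g) = 137. -/

import Mathlib

open MvPolynomial

/-- The Milnor number of a polynomial `F ∈ ℂ[x,y,z]`: the `ℂ`-dimension of the quotient of the
formal power series ring `ℂ⟦x,y,z⟧` by the ideal generated by the three partial derivatives. -/
noncomputable def milnorNumber (F : MvPolynomial (Fin 3) ℂ) : ℕ :=
  Module.finrank ℂ (MvPowerSeries (Fin 3) ℂ ⧸
    Ideal.span (Set.range fun i : Fin 3 => (pderiv i F).toMvPowerSeries))

/-- `F` has a critical point at the origin of `ℂ³`, and it is isolated. -/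
def HasIsolatedCriticalPointAtOrigin (F : MvPolynomial (Fin 3) ℂ) : Prop :=
  (∀ i, eval (0 : Fin 3 → ℂ) (pderiv i F) = 0) ∧
  ∃ ε > (0 : ℝ), ∀ p : Fin 3 → ℂ, ‖p‖ < ε → (∀ i, eval p (pderiv i F) = 0) → p = 0

/-- The singular sextic `g₆ ∈ ℂ[x,y,z]` of Oka (variables `x = X 0`, `y = X 1`, `z = X 2`). -/
noncomputable def g6 : MvPolynomial (Fin 3) ℂ :=
  X 0 ^ 6 + C 3 * X 0 ^ 5 * X 2 - C (9/4) * X 0 ^ 4 * X 2 ^ 2 - C 4 * X 0 ^ 4 * X 1 * X 2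
  - X 0 ^ 4 * X 1 ^ 2 - C (3/2) * X 0 ^ 3 * X 2 ^ 3 + C (63/16) * X 0 ^ 2 * X 2 ^ 4
  + C 10 * X 0 ^ 2 * X 1 * X 2 ^ 3 + C (47/6) * X 0 ^ 2 * X 1 ^ 2 * X 2 ^ 2
  + C (8/3) * X 0 ^ 2 * X 1 ^ 3 * X 2 + C (1/3) * X 0 ^ 2 * X 1 ^ 4
  + C (51/16) * X 0 * X 2 ^ 5 + C 8 * X 0 * X 1 * X 2 ^ 4 + C (22/3) * X 0 * X 1 ^ 2 * X 2 ^ 3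
  + C (8/3) * X 0 * X 1 ^ 3 * X 2 ^ 2 + C (1/3) * X 0 * X 1 ^ 4 * X 2
  - C (215/64) * X 2 ^ 6 - C (41/4) * X 1 * X 2 ^ 5 - C (571/48) * X 1 ^ 2 * X 2 ^ 4
  - C (190/27) * X 1 ^ 3 * X 2 ^ 3 - C (85/36) * X 1 ^ 4 * X 2 ^ 2 - C (4/9) * X 1 ^ 5 * X 2
  - C (1/27) * X 1 ^ 6

namespace OkaSextic

/-- Exponents of the monomials in three variables. -/
abbrev Exponent := ℕ × ℕ × ℕ

/-- Polynomials in three variables with integer coefficients, as lists of terms. -/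
abbrev Sparse := List (ℤ × Exponent)

/-- A homogeneous polynomial with a distinguished term, to be rewritten in terms of the others. -/
abbrev Rule := (ℤ × Exponent) × Sparse

/-- The total degree of a monomial. -/
def deg (e : Exponent) : ℕ := e.1 + e.2.1 + e.2.2

/-- The weight that grows when a monomial is rewritten by a rule. -/
def weight (e : Exponent) : ℕ := e.1 + 16 * e.2.1

/-- The terms of a rule. -/
def terms (G : Rule) : Sparse := G.1 :: G.2

/-- A rule is admissible if it is homogeneous and its distinguished term has the least weight. -/
abbrev IsAdmissible (G : Rule) : Prop :=
  G.1.1 ≠ 0 ∧ ∀ t ∈ G.2, deg t.2 = deg G.1.2 ∧ weight G.1.2 < weight t.2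

/-- The monomials of degree less than `n` to which no rule applies. -/
def standardMonomials (B : List Rule) (n : ℕ) : Finset Exponent :=
  (Finset.range n ×ˢ Finset.range n ×ˢ Finset.range n).filter
    fun e => deg e < n ∧ ∀ G ∈ B, ¬ G.1.2 ≤ e

/-- Adds a term to a polynomial. -/
def insertTerm (t : ℤ × Exponent) : Sparse → Sparse
  | [] => [t]
  | s :: p => if s.2 = t.2 then (s.1 + t.1, s.2) :: p else s :: insertTerm t p

/-- A polynomial is zero if all coefficients vanish after collecting terms. -/
abbrev IsZero (p : Sparse) : Prop := ∀ t ∈ p.foldr insertTerm [], t.1 = 0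

/-- The product of two polynomials. -/
def mulSparse (p q : Sparse) : Sparse :=
  p.flatMap fun s => q.map fun t => (s.1 * t.1, s.2 + t.2)

/-- The product of a monomial and a rule. -/
def shift (s : Exponent) (G : Rule) : Rule :=
  ((G.1.1, s + G.1.2), G.2.map fun t => (t.1, s + t.2))

/-- A rule `G`, an integer `c` and a list of pairs `(j, q)`, such that `c G` is the sum of the
products of `q` and the `j`-th element of a given list of rules. -/
abbrev Derivation := Rule × ℤ × List (ℕ × Sparse)

/-- Validity of a derivation from the rules in `S`. -/
abbrev IsDerivation (S : List Rule) (D : Derivation) : Prop :=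
  D.2.1 ≠ 0 ∧
  (∀ s ∈ D.2.2, ∀ t ∈ s.2, deg D.1.1.2 ≤ deg t.2 + deg (S.getD s.1 default).1.2) ∧
  IsZero (mulSparse [(-D.2.1, 0)] (terms D.1) ++
    D.2.2.flatMap fun s => mulSparse s.2 (terms (S.getD s.1 default)))

/-- Validity of a chain of derivations, each of which may use the results of its predecessors. -/
def isDerivationChain : List Rule → List Derivation → Bool
  | _, [] => true
  | S, D :: L => decide (IsDerivation S D) && isDerivationChain (S ++ [D.1]) L

lemma deg_add (e f : Exponent) : deg (e + f) = deg e + deg f := by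
  simp only [deg, Prod.fst_add, Prod.snd_add]; omega

lemma weight_add (e f : Exponent) : weight (e + f) = weight e + weight f := by
  simp only [weight, Prod.fst_add, Prod.snd_add]; omega

lemma weight_le (e : Exponent) : weight e ≤ 16 * deg e := by
  simp only [weight, deg]; omega

lemma mem_standardMonomials {B : List Rule} {n : ℕ} {e : Exponent} :
    e ∈ standardMonomials B n ↔ deg e < n ∧ ∀ G ∈ B, ¬ G.1.2 ≤ e := by
  rw [standardMonomials, Finset.mem_filter, and_iff_right_iff_imp]
  rintro ⟨h, -⟩
  simp only [deg] at h
  simp only [Finset.mem_product, Finset.mem_range]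
  omega

section Ring

variable {R : Type*} [CommRing R] (u v z : R)

/-- The value of a monomial at three elements of a ring. -/
def monom (e : Exponent) : R := u ^ e.1 * v ^ e.2.1 * z ^ e.2.2

/-- The value of a polynomial at three elements of a ring. -/
def evalSparse (p : Sparse) : R := (p.map fun t => (t.1 : R) * monom u v z t.2).sum

/-- The ideal generated by three elements of a ring. -/
def idealOf : Ideal R := Ideal.span {u, v, z}

lemma monom_add (e f : Exponent) : monom u v z (e + f) = monom u v z e * monom u v z f := by
  simp only [monom, Prod.fst_add, Prod.snd_add]; ring

lemma monom_mem (e : Exponent) : monom u v z e ∈ idealOf u v z ^ deg e := by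
  have h : ∀ x ∈ ({u, v, z} : Set R), ∀ n : ℕ, x ^ n ∈ idealOf u v z ^ n := fun x hx n =>
    Ideal.pow_mem_pow (Ideal.subset_span hx) n
  rw [deg, pow_add, pow_add]
  exact Ideal.mul_mem_mul (Ideal.mul_mem_mul (h u (by simp) _) (h v (by simp) _)) (h z (by simp) _)

lemma evalSparse_mem {p : Sparse} {k : ℕ} (hp : ∀ t ∈ p, k ≤ deg t.2) :
    evalSparse u v z p ∈ idealOf u v z ^ k := by
  refine list_sum_mem fun x hx => ?_
  obtain ⟨t, ht, rfl⟩ := List.mem_map.1 hx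
  exact Ideal.mul_mem_left _ _ (Ideal.pow_le_pow_right (hp t ht) (monom_mem u v z t.2))

lemma map_evalSparse {S : Type*} [CommRing S] (φ : R →+* S) (p : Sparse) :
    φ (evalSparse u v z p) = evalSparse (φ u) (φ v) (φ z) p := by
  simp [evalSparse, map_list_sum, Function.comp_def, monom]

lemma map_idealOf {S : Type*} [CommRing S] (φ : R →+* S) :
    (idealOf u v z).map φ = idealOf (φ u) (φ v) (φ z) := by
  rw [idealOf, Ideal.map_span, Set.image_insert_eq, Set.image_pair, idealOf]

variable {u v z}

lemma mul_mem {I : Ideal R} {j k : ℕ} {a : R} (q : Sparse) (hq : ∀ t ∈ q, k ≤ deg t.2 + j)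
    (ha : a ∈ I ⊔ idealOf u v z ^ (j + 1)) :
    evalSparse u v z q * a ∈ I ⊔ idealOf u v z ^ (k + 1) := by
  obtain ⟨b, hb, c, hc, rfl⟩ := Submodule.mem_sup.1 ha
  rw [mul_add]
  refine Submodule.add_mem_sup (I.mul_mem_left _ hb) ?_
  have hq' : evalSparse u v z q ∈ idealOf u v z ^ (k - j) :=
    evalSparse_mem u v z fun t ht => by have := hq t ht; omega
  have := Ideal.mul_mem_mul hq' hc
  rw [← pow_add] at this
  exact Ideal.pow_le_pow_right (by omega) this

lemma pow_le_span_monom (k : ℕ) :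
    idealOf u v z ^ k ≤ Ideal.span {x | ∃ e, deg e = k ∧ monom u v z e = x} := by
  induction k with
  | zero =>
    rw [pow_zero, Ideal.one_eq_top, top_le_iff, Ideal.eq_top_iff_one]
    exact Ideal.subset_span ⟨0, rfl, by simp [monom]⟩
  | succ k ih =>
    rw [pow_succ]
    refine (Ideal.mul_mono_left ih).trans ?_
    rw [idealOf, Ideal.span_mul_span']
    refine Ideal.span_mono ?_
    rintro _ ⟨_, ⟨e, rfl, rfl⟩, x, hx, rfl⟩
    rcases hx with rfl | rfl | rfl
    · exact ⟨e + (1, 0, 0), by simp [deg]; omega, by simp [monom_add]; simp [monom]⟩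
    · exact ⟨e + (0, 1, 0), by simp [deg]; omega, by simp [monom_add]; simp [monom]⟩
    · exact ⟨e + (0, 0, 1), by simp [deg]; omega, by simp [monom_add]; simp [monom]⟩

end Ring

section Evaluation

variable {R : Type*} [CommRing R] (u v z : R)

lemma evalSparse_cons (t : ℤ × Exponent) (p : Sparse) :
    evalSparse u v z (t :: p) = t.1 * monom u v z t.2 + evalSparse u v z p := by
  simp [evalSparse]

lemma evalSparse_append (p q : Sparse) :
    evalSparse u v z (p ++ q) = evalSparse u v z p + evalSparse u v z q := by
  simp [evalSparse]

lemma evalSparse_mulSparse (p q : Sparse) :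
    evalSparse u v z (mulSparse p q) = evalSparse u v z p * evalSparse u v z q := by
  induction p with
  | nil => simp [mulSparse, evalSparse]
  | cons s p ih =>
    rw [mulSparse, List.flatMap_cons, evalSparse_append, ← mulSparse, ih, evalSparse_cons, add_mul]
    congr 1
    simp only [evalSparse, List.map_map, ← List.sum_map_mul_left]
    congr 2
    ext t
    simp only [Function.comp_apply, Int.cast_mul, monom_add]
    ring

lemma evalSparse_insertTerm (t : ℤ × Exponent) (p : Sparse) :
    evalSparse u v z (insertTerm t p) = t.1 * monom u v z t.2 + evalSparse u v z p := by
  induction p with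
  | nil => simp [insertTerm, evalSparse]
  | cons s p ih =>
    rw [insertTerm]
    split_ifs with h
    · simp only [evalSparse_cons, Int.cast_add, ← h]
      ring
    · simp only [evalSparse_cons, ih]
      ring

lemma evalSparse_eq_zero {p : Sparse} (hp : IsZero p) : evalSparse u v z p = 0 := by
  have h : ∀ p : Sparse, evalSparse u v z (p.foldr insertTerm []) = evalSparse u v z p := by
    intro p
    induction p with
    | nil => rfl
    | cons t p ih => rw [List.foldr_cons, evalSparse_insertTerm, ih, evalSparse_cons]
  rw [← h, evalSparse]
  refine List.sum_eq_zero fun x hx => ?_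
  obtain ⟨t, ht, rfl⟩ := List.mem_map.1 hx
  rw [hp t ht, Int.cast_zero, zero_mul]

lemma evalSparse_shift (s : Exponent) (G : Rule) :
    evalSparse u v z (terms (shift s G)) = monom u v z s * evalSparse u v z (terms G) := by
  have h : terms (shift s G) = mulSparse [(1, s)] (terms G) := by
    simp [terms, shift, mulSparse]
  rw [h, evalSparse_mulSparse]
  simp [evalSparse]

end Evaluation

section Algebra

variable {R : Type*} [CommRing R] [Algebra ℂ R] {u v z : R}

lemma mem_of_intCast_mul_mem {N : Submodule ℂ R} {x y : R} (c : ℤ) (hc : c ≠ 0) (hy : y ∈ N)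
    (h : (c : R) * x = y) : x ∈ N := by
  have hx : x = (c : ℂ)⁻¹ • y := by
    rw [← h, ← zsmul_eq_mul, ← Int.cast_smul_eq_zsmul ℂ, smul_smul,
      inv_mul_cancel₀ (Int.cast_ne_zero.2 hc), one_smul]
  exact hx ▸ N.smul_mem _ hy

lemma mem_ideal_of_intCast_mul_mem {N : Ideal R} {x y : R} (c : ℤ) (hc : c ≠ 0) (hy : y ∈ N)
    (h : (c : R) * x = y) : x ∈ N :=
  mem_of_intCast_mul_mem (N := N.restrictScalars ℂ) c hc hy h

/-- A rule holds modulo `I` and terms of higher order. -/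
abbrev Holds (u v z : R) (I : Ideal R) (G : Rule) : Prop :=
  evalSparse u v z (terms G) ∈ I ⊔ idealOf u v z ^ (deg G.1.2 + 1)

lemma holds_of_isDerivation {I : Ideal R} {S : List Rule} (hS : ∀ G ∈ S, Holds u v z I G)
    {D : Derivation} (hD : IsDerivation S D) : Holds u v z I D.1 := by
  obtain ⟨hc, hdeg, hzero⟩ := hD
  have hget : ∀ j, Holds u v z I (S.getD j default) := by
    intro j
    rcases lt_or_ge j S.length with hj | hj
    · rw [List.getD_eq_getElem _ _ hj]
      exact hS _ (List.getElem_mem hj)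
    · rw [List.getD_eq_default _ _ hj]
      have h0 : evalSparse u v z (terms default) = 0 := by
        simp [evalSparse, terms, default]
      rw [Holds, h0]
      exact Submodule.zero_mem _
  have h := evalSparse_eq_zero u v z hzero
  rw [evalSparse_append, evalSparse_mulSparse] at h
  have hc' : evalSparse u v z [(-D.2.1, 0)] = -(D.2.1 : R) := by simp [evalSparse, monom]
  rw [hc', neg_mul, neg_add_eq_zero] at h
  refine mem_ideal_of_intCast_mul_mem D.2.1 hc ?_ h
  have hsum : ∀ L : List (ℕ × Sparse), (∀ s ∈ L, s ∈ D.2.2) →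
      evalSparse u v z (L.flatMap fun s => mulSparse s.2 (terms (S.getD s.1 default))) ∈
        I ⊔ idealOf u v z ^ (deg D.1.1.2 + 1) := by
    intro L hL
    induction L with
    | nil => simp [evalSparse]
    | cons s L ih =>
      rw [List.flatMap_cons, evalSparse_append, evalSparse_mulSparse]
      exact add_mem (mul_mem _ (hdeg s (hL s (by simp))) (hget s.1))
        (ih fun t ht => hL t (by simp [ht]))
  exact hsum _ fun _ hs => hs

lemma holds_of_isDerivationChain {I : Ideal R} (S : List Rule) (L : List Derivation)
    (hL : isDerivationChain S L = true) (hS : ∀ G ∈ S, Holds u v z I G) :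
    ∀ G ∈ S ++ L.map Prod.fst, Holds u v z I G := by
  induction L generalizing S with
  | nil => simpa using hS
  | cons D L ih =>
    rw [isDerivationChain, Bool.and_eq_true, decide_eq_true_eq] at hL
    have := ih (S ++ [D.1]) hL.2 (List.forall_mem_append.2
      ⟨hS, List.forall_mem_singleton.2 (holds_of_isDerivation hS hL.1)⟩)
    rwa [List.append_assoc] at this

lemma pow_le_of_monom_mem (hR : ∀ r : R, ∃ c : ℂ, r - algebraMap ℂ R c ∈ idealOf u v z) {k : ℕ}
    {W : Submodule ℂ R} (hW : (idealOf u v z ^ (k + 1)).restrictScalars ℂ ≤ W)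
    (h : ∀ e, deg e = k → monom u v z e ∈ W) :
    (idealOf u v z ^ k).restrictScalars ℂ ≤ W := by
  intro x hx
  have hx' := pow_le_span_monom k hx
  have hle : Ideal.span {x | ∃ e, deg e = k ∧ monom u v z e = x} ≤ idealOf u v z ^ k := by
    refine Ideal.span_le.2 ?_
    rintro _ ⟨e, rfl, rfl⟩
    exact monom_mem u v z e
  clear hx
  induction hx' using Submodule.span_induction with
  | mem x hx => obtain ⟨e, he, rfl⟩ := hx; exact h e he
  | zero => exact W.zero_mem
  | add x y hx hy ihx ihy => exact W.add_mem ihx ihy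
  | smul r x hx ih =>
    obtain ⟨c, hc⟩ := hR r
    have h1 : (r - algebraMap ℂ R c) * x ∈ W := by
      refine hW ?_
      rw [Submodule.restrictScalars_mem, pow_succ']
      exact Ideal.mul_mem_mul hc (hle hx)
    have h2 : r • x = (r - algebraMap ℂ R c) * x + c • x := by
      rw [smul_eq_mul, Algebra.smul_def]; ring
    exact h2 ▸ W.add_mem h1 (W.smul_mem c ih)

/-- If every monomial of degree `k` to which no rule applies lies in a subspace `W` containing
`I` and all elements of order `> k`, and the rules hold modulo `I` and higher order terms, then
`W` contains all elements of order `≥ k`. -/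
lemma pow_le_of_rules (hR : ∀ r : R, ∃ c : ℂ, r - algebraMap ℂ R c ∈ idealOf u v z)
    {I : Ideal R} {B : List Rule} (hB : ∀ G ∈ B, IsAdmissible G)
    (hI : ∀ G ∈ B, Holds u v z I G) {k : ℕ}
    {W : Submodule ℂ R} (hIW : I.restrictScalars ℂ ≤ W)
    (hW : (idealOf u v z ^ (k + 1)).restrictScalars ℂ ≤ W)
    (h : ∀ e, deg e = k → (∀ G ∈ B, ¬ G.1.2 ≤ e) → monom u v z e ∈ W) :
    (idealOf u v z ^ k).restrictScalars ℂ ≤ W := by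
  refine pow_le_of_monom_mem hR hW fun e he => ?_
  induction hn : 16 * k - weight e using Nat.strong_induction_on generalizing e with
  | _ n ih =>
    by_cases hstd : ∀ G ∈ B, ¬ G.1.2 ≤ e
    · exact h e he hstd
    push Not at hstd
    obtain ⟨G, hG, hle⟩ := hstd
    obtain ⟨s, rfl⟩ := exists_add_of_le hle
    obtain ⟨hc, ht⟩ := hB G hG
    have htail : ((G.2.map fun t => (t.1 : R) * monom u v z t.2).sum) * monom u v z s ∈ W := by
      rw [← List.sum_map_mul_right]
      refine list_sum_mem fun x hx => ?_
      obtain ⟨t, htG, rfl⟩ := List.mem_map.1 hx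
      obtain ⟨hd, hw⟩ := ht t htG
      rw [mul_assoc, ← monom_add, ← zsmul_eq_mul]
      have h1 := weight_le (G.1.2 + s)
      have h2 := weight_le (t.2 + s)
      rw [deg_add] at he h1 h2
      rw [weight_add] at hn h1 h2
      refine zsmul_mem (ih _ ?_ (t.2 + s) (by rw [deg_add]; omega) rfl) _
      rw [weight_add]
      omega
    have hall : evalSparse u v z (terms G) * monom u v z s ∈ W := by
      obtain ⟨b, hb, c, hc, hbc⟩ := Submodule.mem_sup.1 (hI G hG)
      rw [← hbc, add_mul]
      refine W.add_mem (hIW (I.mul_mem_right _ hb)) (hW ?_)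
      have := Ideal.mul_mem_mul hc (monom_mem u v z s)
      rw [← pow_add] at this
      rw [deg_add] at he
      exact Ideal.pow_le_pow_right (by omega) this
    refine mem_of_intCast_mul_mem G.1.1 hc (W.sub_mem hall htail) ?_
    rw [monom_add]
    simp only [evalSparse, terms, List.map_cons, List.sum_cons]
    ring

/-- The codimension of an ideal is bounded by the number of monomials to which no rule applies. -/
lemma finrank_quotient_le (hR : ∀ r : R, ∃ c : ℂ, r - algebraMap ℂ R c ∈ idealOf u v z)
    {I : Ideal R} {B : List Rule} (hB : ∀ G ∈ B, IsAdmissible G)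
    (hI : ∀ G ∈ B, Holds u v z I G) {n : ℕ}
    (hn : idealOf u v z ^ n ≤ I) :
    Module.Finite ℂ (R ⧸ I) ∧ Module.finrank ℂ (R ⧸ I) ≤ (standardMonomials B n).card := by
  classical
  set S : Finset R := (standardMonomials B n).image (monom u v z) with hS
  set W : Submodule ℂ R := I.restrictScalars ℂ ⊔ Submodule.span ℂ (S : Set R) with hWdef
  have hW : ∀ k ≤ n, (idealOf u v z ^ (n - k)).restrictScalars ℂ ≤ W := by
    intro k hk
    induction k with
    | zero => exact le_trans hn le_sup_left
    | succ k ih =>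
      refine pow_le_of_rules hR hB hI le_sup_left ?_ fun e he hstd => ?_
      · have : n - (k + 1) + 1 = n - k := by omega
        exact this ▸ ih (by omega)
      · refine Submodule.mem_sup_right (Submodule.subset_span ?_)
        exact Finset.mem_image_of_mem _ (mem_standardMonomials.2 ⟨by omega, hstd⟩)
  have htop : W = ⊤ := by
    have := hW n le_rfl
    rw [Nat.sub_self, pow_zero, Ideal.one_eq_top] at this
    exact top_le_iff.1 this
  set π : R →ₗ[ℂ] R ⧸ I := (Ideal.Quotient.mkₐ ℂ I).toLinearMap with hπ
  have hspan : Submodule.span ℂ ((S.image π : Finset (R ⧸ I)) : Set (R ⧸ I)) = ⊤ := by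
    rw [eq_top_iff]
    have h1 : Submodule.map π W = ⊤ := by
      rw [htop, Submodule.map_top, LinearMap.range_eq_top]
      exact Ideal.Quotient.mk_surjective
    rw [← h1, hWdef, Submodule.map_sup, Submodule.map_span, Finset.coe_image (f := π)]
    refine sup_le ?_ le_rfl
    rintro _ ⟨x, hx, rfl⟩
    have : π x = 0 := Ideal.Quotient.eq_zero_iff_mem.2 hx
    rw [this]
    exact Submodule.zero_mem _
  refine ⟨⟨⟨_, hspan⟩⟩, ?_⟩
  rw [← finrank_top, ← hspan]
  exact (finrank_span_finset_le_card _).trans (Finset.card_image_le.trans Finset.card_image_le)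

/-- Adding a generator `f` to an ideal `I` lowers the codimension at most by that of any ideal
`K` with `f K ⊆ I`. -/
lemma finrank_quotient_le_add {I K : Ideal R} [Module.Finite ℂ (R ⧸ I)] [Module.Finite ℂ (R ⧸ K)]
    (f : R) (hK : ∀ x ∈ K, f * x ∈ I) :
    Module.finrank ℂ (R ⧸ I) ≤
      Module.finrank ℂ (R ⧸ (I ⊔ Ideal.span {f})) + Module.finrank ℂ (R ⧸ K) := by
  let ψ : (R ⧸ I) →ₗ[ℂ] R ⧸ (I ⊔ Ideal.span {f}) :=
    (Ideal.Quotient.factorₐ ℂ (le_sup_left : I ≤ I ⊔ Ideal.span {f})).toLinearMap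
  let φ : (R ⧸ K) →ₗ[ℂ] R ⧸ I :=
    (Submodule.mapQ K I (LinearMap.mulLeft R f) hK).restrictScalars ℂ
  have hker : LinearMap.ker ψ ≤ LinearMap.range φ := by
    intro x hx
    obtain ⟨r, rfl⟩ := Ideal.Quotient.mk_surjective x
    have hr : r ∈ I ⊔ Ideal.span {f} := Ideal.Quotient.eq_zero_iff_mem.1 hx
    obtain ⟨a, ha, b, hb, rfl⟩ := Submodule.mem_sup.1 hr
    obtain ⟨c, rfl⟩ := Ideal.mem_span_singleton'.1 hb
    refine ⟨Ideal.Quotient.mk K c, ?_⟩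
    change Ideal.Quotient.mk I (f * c) = _
    rw [Ideal.Quotient.eq]
    have : f * c - (a + c * f) = -a := by ring
    rw [this]
    exact I.neg_mem ha
  have hsurj : Function.Surjective ψ :=
    Ideal.Quotient.factor_surjective (le_sup_left : I ≤ I ⊔ Ideal.span {f})
  rw [← LinearMap.finrank_range_add_finrank_ker ψ, LinearMap.range_eq_top.2 hsurj, finrank_top]
  exact Nat.add_le_add_left
    ((Submodule.finrank_mono hker).trans (LinearMap.finrank_range_le φ)) _

end Algebra

/-- The partial derivative of `g` with respect to `u`, up to a constant factor. -/
def firstPartial : Rule :=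
  ((4, 1, 0, 4), [(-12, 3, 0, 2), (9, 5, 0, 0), (-5, 1, 2, 2), (9, 2, 2, 1), (-6, 3, 2, 0), (1, 1,
    4, 0)])

/-- The partial derivative of `g` with respect to `v`, up to a constant factor. -/
def secondPartial : Rule :=
  ((-5, 0, 1, 4), [(15, 2, 1, 2), (-18, 3, 1, 1), (9, 4, 1, 0), (4, 0, 3, 2), (-6, 2, 3, 0), (1,
    0, 5, 0)])

/-- The partial derivative of `g₆` with respect to `z`, up to a constant factor. -/
def thirdPartial : Rule :=
  ((-8, 0, 0, 5), [(24, 2, 0, 3), (-18, 4, 0, 1), (10, 0, 2, 3), (-15, 2, 2, 1), (9, 3, 2, 0),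
    (-2, 0, 4, 1)])

/-- The coefficient of `thirdPartial` in a syzygy between the partial derivatives of `g₆`. -/
def firstMultiplier : Rule :=
  ((-8, 2, 0, 2), [(1, 3, 0, 1), (9, 4, 0, 0), (5, 0, 2, 2), (-3, 1, 2, 1), (-6, 2, 2, 0), (1, 0,
    4, 0)])

/-- The coefficient of `firstPartial` in the syzygy of `firstMultiplier`. -/
def firstSyzygyLeft : Sparse :=
  [(-16, 1, 0, 3), (2, 2, 0, 2), (18, 3, 0, 1), (-1, 0, 2, 2), (-2, 1, 2, 1), (-5, 2, 2, 0), (1,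
    0, 4, 0)]

/-- The coefficient of `secondPartial` in the syzygy of `firstMultiplier`. -/
def firstSyzygyRight : Sparse :=
  [(-8, 0, 1, 3), (4, 1, 1, 2), (8, 2, 1, 1), (-4, 3, 1, 0), (2, 0, 3, 1), (-1, 1, 3, 0)]

/-- The coefficient of `thirdPartial` in a syzygy between the partial derivatives of `g₆`. -/
def secondMultiplier : Rule :=
  ((-1, 1, 0, 3), [(-1, 2, 0, 2), (2, 3, 0, 1), (1, 1, 2, 1)])

/-- The coefficient of `firstPartial` in the syzygy of `secondMultiplier`. -/
def secondSyzygyLeft : Sparse :=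
  [(-2, 0, 0, 4), (-2, 1, 0, 3), (4, 2, 0, 2), (2, 0, 2, 2), (2, 1, 2, 1), (-1, 2, 2, 0)]

/-- The coefficient of `secondPartial` in the syzygy of `secondMultiplier`. -/
def secondSyzygyRight : Sparse :=
  [(-2, 2, 1, 1), (1, 3, 1, 0)]

/-- The seeds of `jacobianBasis`. -/
def jacobianSeeds : List Rule :=
  [firstPartial, secondPartial, thirdPartial, shift (0, 0, 6) firstMultiplier,
    shift (0, 0, 6) secondMultiplier]

/-- The elements of `jacobianBasis` that are derived from its seeds. -/
def jacobianDerivations : List Derivation :=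
  [
    (((8, 4, 1, 1), [(-9, 5, 1, 0), (1, 1, 3, 2), (-5, 2, 3, 1), (6, 3, 3, 0), (-1, 1, 5, 0)]), 9,
      [(1, [(-4, 1, 0, 0)]), (0, [(-5, 0, 1, 0)])]),
    (((-2, 2, 2, 2), [(3, 3, 2, 1), (-1, 4, 2, 0)]), 9, [(2, [(-1, 1, 0, 0)]), (0, [(-2, 0, 0,
      1)])]),
    (((-64, 3, 1, 2), [(81, 5, 1, 0), (-8, 0, 3, 3), (-9, 1, 3, 2), (57, 2, 3, 1), (-74, 3, 3, 0),
      (8, 0, 5, 1), (9, 1, 5, 0)]), 9, [(2, [(-20, 0, 1, 0)]), (1, [(32, 0, 0, 1)]), (5, [(-81, 0,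
      0, 0)])]),
    (((-5, 5, 2, 0), [(8, 0, 4, 3), (-3, 1, 4, 2), (3, 2, 4, 1), (2, 3, 4, 0), (-8, 0, 6, 1), (3,
      1, 6, 0)]), 1, [(7, [(-1, 0, 1, 0)]), (6, [(32, 1, 0, 0)]), (5, [(-12, 0, 1, 0)])]),
    (((1, 1, 4, 3), [(6, 3, 4, 1), (-7, 4, 4, 0), (-1, 1, 6, 1), (1, 2, 6, 0)]), 32, [(6, [(-128,
      0, 0, 2), (-192, 1, 0, 1), (212, 0, 2, 0)]), (0, [(-64, 1, 2, 0)]), (5, [(-40, 0, 1, 1),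
      (-69, 1, 1, 0)]), (8, [(9, 1, 0, 0)])]),
    (((-1500, 7, 1, 0), [(11534, 0, 5, 3), (-8534, 1, 5, 2), (22329, 2, 5, 1), (-20829, 3, 5, 0),
      (-11534, 0, 7, 1), (8534, 1, 7, 0)]), 12, [(7, [(-5120, 0, 0, 2)]), (0, [(-81920, 2, 1, 0),
      (-11520, 0, 3, 0)]), (5, [(-71040, 1, 0, 1), (-79920, 2, 0, 0), (-58953, 0, 2, 0)]), (1,
      [(8192, 0, 2, 1)]), (6, [(-120000, 0, 1, 1), (347272, 1, 1, 0)]), (8, [(18325, 0, 1, 0)])]),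
    (((-213, 3, 4, 1), [(209, 4, 4, 0), (4, 0, 6, 2), (4, 2, 6, 0), (-4, 0, 8, 0)]), 16, [(8,
      [(-40, 0, 0, 1), (45, 1, 0, 0)]), (5, [(-25, 1, 1, 0)]), (1, [(-64, 0, 3, 0)]), (9, [(-480,
      0, 0, 0)]), (6, [(-620, 0, 2, 0)])]),
    (((-106, 0, 6, 3), [(106, 1, 6, 2), (-411, 2, 6, 1), (411, 3, 6, 0), (106, 0, 8, 1), (-106, 1,
      8, 0)]), 12, [(6, [(-2560, 0, 0, 3), (9520, 0, 2, 1), (-780, 1, 2, 0)]), (2, [(640, 2, 2,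
      0)]), (0, [(1920, 2, 2, 0), (560, 0, 4, 0)]), (5, [(-2240, 0, 1, 2), (360, 1, 1, 1), (1845,
      2, 1, 0), (1355, 0, 3, 0)]), (8, [(135, 2, 0, 0), (-159, 0, 2, 0)])]),
    (((-1, 4, 5, 0), [(1, 0, 7, 2), (1, 2, 7, 0), (-1, 0, 9, 0)]), 39321600, [(7, [(-58163200, 0,
      0, 3)]), (2, [(465305600, 3, 1, 0)]), (5, [(-807014400, 1, 0, 2), (-907891200, 2, 0, 1),
      (25560000, 3, 0, 0), (-1293838680, 0, 2, 1), (1009724725, 1, 2, 0)]), (10, [(-153360, 1, 0,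
      0)]), (1, [(93061120, 0, 2, 2), (-18612224, 0, 4, 0)]), (0, [(-130867200, 0, 3, 1),
      (681600000, 1, 3, 0)]), (6, [(5989809920, 1, 1, 1), (1669279580, 0, 3, 0)]), (8,
      [(277597575, 1, 1, 0)]), (9, [(711045120, 0, 1, 0)]), (11, [(5177344, 0, 1, 0)])]),
    (((-1, 2, 6, 1), [(1, 3, 6, 0)]), 7680, [(8, [(-16960, 0, 0, 2), (20140, 2, 0, 0), (-3657, 0,
      2, 0)]), (6, [(42400, 3, 0, 0), (-148400, 0, 2, 1), (42824, 1, 2, 0)]), (5, [(-15900, 2, 1,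
      0), (-21571, 0, 3, 0)]), (1, [(-27136, 0, 3, 1)]), (0, [(-12720, 0, 4, 0)]), (12, [(-20, 0,
      0, 0)])]),
    (((27, 7, 0, 3), [(-189, 8, 0, 2), (-27, 9, 0, 1), (243, 10, 0, 0), (-200, 0, 8, 2), (-12, 1,
      8, 1), (-70, 2, 8, 0), (224, 0, 10, 0)]), 2181120, [(3, [(8724480, 0, 0, 0)]), (0,
      [(17448960, 1, 0, 4), (-2181120, 2, 0, 3), (32716800, 3, 0, 2), (-6543360, 4, 0, 1),
      (58890240, 5, 0, 0), (6543360, 0, 2, 3), (2181120, 1, 2, 2), (16903680, 2, 2, 1), (58890240,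
      3, 2, 0), (8179200, 0, 4, 1), (-29854080, 1, 4, 0)]), (1, [(8724480, 0, 1, 4), (8724480, 0,
      3, 2), (8724480, 0, 5, 0)]), (5, [(-24537600, 1, 1, 2), (126982080, 2, 1, 1), (52679160, 3,
      1, 0), (139818312, 0, 3, 1), (18599373, 1, 3, 0)]), (8, [(-59488344, 3, 0, 0), (-106686801,
      1, 2, 0)]), (6, [(-293878656, 1, 2, 1), (-16154772, 0, 4, 0)]), (9, [(748028736, 0, 2, 0)]),
      (11, [(22331392, 0, 2, 0)]), (13, [(-569171968, 0, 1, 0)])]),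
    (((-216, 8, 0, 2), [(27, 9, 0, 1), (243, 10, 0, 0), (-168, 0, 8, 2), (-38, 2, 8, 0), (168, 0,
      10, 0)]), 2181120, [(4, [(34897920, 0, 0, 0)]), (0, [(8724480, 0, 0, 5), (8724480, 1, 0, 4),
      (8724480, 2, 0, 3), (26173440, 3, 0, 2), (6543360, 4, 0, 1), (58890240, 5, 0, 0), (2181120,
      0, 2, 3), (-8724480, 1, 2, 2), (10905600, 2, 2, 1), (545280, 0, 4, 1), (-16767360, 1, 4,
      0)]), (5, [(-4907520, 1, 1, 2), (53369280, 2, 1, 1), (-13572360, 3, 1, 0), (55899720, 0, 3,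
      1), (11217645, 1, 3, 0)]), (8, [(-46238040, 3, 0, 0), (-73377009, 1, 2, 0)]), (6,
      [(-217975680, 1, 2, 1), (18388716, 0, 4, 0)]), (9, [(531661632, 0, 2, 0)]), (11, [(16326656,
      0, 2, 0)]), (13, [(-431734784, 0, 1, 0)])]),
    (((-837, 10, 0, 1), [(1701, 11, 0, 0), (-4784, 1, 8, 2), (-3312, 3, 8, 0), (192, 0, 10, 1),
      (6032, 1, 10, 0)]), 678400, [(15, [(5427200, 0, 0, 1), (37990400, 1, 0, 0)]), (0,
      [(-36633600, 6, 0, 0), (3319920, 0, 6, 0)]), (16, [(-31884800, 1, 0, 0)]), (5, [(-22896000,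
      3, 1, 1), (15454800, 4, 1, 0), (-13279680, 0, 3, 2), (-25128360, 1, 3, 1), (-7491285, 2, 3,
      0), (-30015225, 0, 5, 0)]), (8, [(16141680, 4, 0, 0), (31160025, 2, 2, 0), (35973909, 0, 4,
      0)]), (6, [(145275120, 0, 4, 1), (170489340, 1, 4, 0)]), (12, [(-7524988, 0, 2, 0)]), (14,
      [(2320706560, 0, 2, 0)])]),
    (((4, 0, 9, 2), [(-3, 1, 9, 1), (-4, 2, 9, 0), (2, 0, 11, 0)]), 93061120, [(15, [(23265280, 0,
      1, 0)]), (5, [(-78520320, 3, 0, 2), (461306880, 4, 0, 1), (597490560, 5, 0, 0), (-106738560,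
      1, 2, 2), (181884960, 2, 2, 1), (232072020, 3, 2, 0), (-505060488, 0, 4, 1), (-818426727, 1,
      4, 0)]), (10, [(184032, 3, 0, 0)]), (0, [(19630080, 3, 3, 0), (26684640, 1, 5, 0)]), (8,
      [(334593180, 3, 1, 0), (1023829443, 1, 3, 0)]), (6, [(2757474144, 1, 3, 1), (-695648628, 0,
      5, 0)]), (9, [(-7685575056, 0, 3, 0)]), (11, [(-229146624, 0, 3, 0)]), (13, [(5941886976, 0,
      2, 0)])]),
    (((-9, 1, 9, 1), [(-16, 2, 9, 0), (18, 0, 11, 0)]), 5816320, [(16, [(-1454080, 0, 1, 0)]), (5,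
      [(-39260160, 4, 0, 1), (-39260160, 5, 0, 0), (4907520, 1, 2, 2), (-14109120, 2, 2, 1),
      (-10965240, 3, 2, 0), (25074360, 0, 4, 1), (21192435, 1, 4, 0)]), (8, [(-27374760, 3, 1, 0),
      (-56610927, 1, 3, 0)]), (0, [(-1226880, 1, 5, 0)]), (6, [(-128822400, 1, 3, 1), (33440148,
      0, 5, 0)]), (9, [(427813056, 0, 3, 0)]), (11, [(12976128, 0, 3, 0)]), (13, [(-365985792, 0,
      2, 0)]), (18, [(17448960, 0, 0, 0)])]),
    (((6075, 11, 0, 0), [(-36412, 1, 8, 2), (-24171, 3, 8, 0), (4512, 0, 10, 1), (41932, 1, 10,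
      0)]), 106, [(16, [(-13144, 0, 0, 1), (90365, 1, 0, 0)]), (15, [(-105152, 1, 0, 0)]), (17,
      [(2491, 0, 0, 0)]), (12, [(20832, 0, 2, 0)]), (14, [(-6800656, 0, 2, 0)])]),
    (((-3, 3, 9, 0), [(8, 0, 11, 1), (-6, 1, 11, 0)]), 2084044800, [(15, [(694681600, 0, 1, 1)]),
      (1, [(3751280640, 7, 0, 0)]), (5, [(16411852800, 4, 0, 2), (13774233600, 5, 0, 1),
      (2835440640, 6, 0, 0), (8535628800, 2, 2, 2), (-2481926400, 3, 2, 1), (-11350692000, 4, 2,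
      0), (-14224368960, 0, 4, 2), (-15908312520, 1, 4, 1), (-36609408945, 2, 4, 0),
      (-40872400875, 0, 6, 0)]), (10, [(5495040, 4, 0, 0)]), (0, [(-4102963200, 4, 3, 0),
      (-2133907200, 2, 5, 0), (3556092240, 0, 7, 0)]), (8, [(11946903840, 4, 1, 0), (35429320485,
      2, 3, 0), (38895943743, 0, 5, 0)]), (6, [(169324048080, 0, 5, 1), (159365461500, 1, 5, 0)]),
      (12, [(1624822924, 0, 3, 0)]), (18, [(-694681600, 1, 0, 0)]), (14, [(-628817474560, 0, 3,
      0)])]),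
    (((50, 0, 11, 1), [(-51, 1, 11, 0)]), 4081254400, [(17, [(-16281600, 0, 1, 0)]), (5,
      [(-1703462400, 6, 0, 0), (212932800, 3, 2, 1), (-825114600, 4, 2, 0), (12416042880, 0, 4,
      2), (5201913960, 1, 4, 1), (28392377985, 2, 4, 0), (20037362850, 0, 6, 0)]), (10,
      [(-8242560, 4, 0, 0)]), (8, [(-558948600, 4, 1, 0), (-17642448405, 2, 3, 0), (-15882116634,
      0, 5, 0)]), (0, [(-3104010720, 0, 7, 0)]), (6, [(-99008943840, 0, 5, 1), (-64986146100, 1,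
      5, 0)]), (12, [(-1198650312, 0, 3, 0)]), (18, [(-5405491200, 1, 0, 0)]), (14,
      [(469030164480, 0, 3, 0)]), (21, [(25898598400, 0, 0, 0)])]),
    (((1, 2, 11, 0), []), 23823646720, [(16, [(-4466933760, 0, 1, 2)]), (1, [(192971538432, 8, 0,
      0), (150088974336, 0, 8, 0)]), (5, [(15075901440, 5, 0, 2), (-209178132480, 6, 0, 1),
      (198860562432, 7, 0, 0), (35569704960, 3, 2, 2), (-229024143360, 4, 2, 1), (23519289600, 5,
      2, 0), (143854133760, 1, 4, 2), (-78193356480, 2, 4, 1), (190984498920, 3, 4, 0),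
      (136398859416, 0, 6, 1), (145268931519, 1, 6, 0)]), (10, [(-35334144, 5, 0, 0)]), (0,
      [(-3768975360, 5, 3, 0), (-8892426240, 3, 5, 0), (-35963533440, 1, 7, 0)]), (8,
      [(-42052048128, 5, 1, 0), (-197836194312, 3, 3, 0), (-256497803307, 1, 5, 0)]), (6,
      [(-1190076789888, 1, 5, 1), (1344904837860, 0, 7, 0)]), (9, [(1915583567040, 0, 5, 0)]),
      (11, [(63316340736, 0, 5, 0)]), (13, [(-389060149248, 0, 4, 0)]), (18, [(71470940160, 0, 2,
      0)]), (19, [(-23823646720, 0, 2, 0)])]),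
    (((-1, 0, 13, 0), []), 2501482905600, [(17, [(-930611200, 0, 1, 1)]), (7, [(12170649600, 7, 0,
      0)]), (5, [(197871206400, 7, 0, 0), (12170649600, 3, 2, 2), (2650060800, 4, 2, 1),
      (39934944000, 5, 2, 0), (785983495680, 1, 4, 2), (296352250560, 2, 4, 1), (1828988766360, 3,
      4, 0), (951743341800, 0, 6, 1), (856350594225, 1, 6, 0)]), (10, [(-530012160, 5, 0, 0)]),
      (8, [(-14563065600, 5, 1, 0), (-1065302281080, 3, 3, 0), (-1044156423429, 1, 5, 0)]), (0,
      [(-3042662400, 3, 5, 0), (-196495873920, 1, 7, 0)]), (6, [(-6077991738240, 1, 5, 1),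
      (-286700485284, 0, 7, 0)]), (9, [(2949464064832, 0, 5, 0)]), (11, [(115834310656, 0, 5,
      0)]), (13, [(3050650648576, 0, 4, 0)]), (18, [(-833827635200, 0, 2, 0)]), (19,
      [(148897792000, 0, 2, 0)]), (23, [(-3231082086400, 0, 0, 0)])])]

/-- Rules for the ideal of partial derivatives of `g`. -/
def jacobianBasis : List Rule := jacobianSeeds ++ jacobianDerivations.map Prod.fst

/-- The monomials of degree four. -/
def quarticMonomials : List Exponent :=
  [(0, 0, 4), (0, 1, 3), (0, 2, 2), (0, 3, 1), (0, 4, 0), (1, 0, 3), (1, 1, 2), (1, 2, 1), (1, 3,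
    0), (2, 0, 2), (2, 1, 1), (2, 2, 0), (3, 0, 1), (3, 1, 0), (4, 0, 0)]

/-- The seeds of `colonBasis`. -/
def colonSeeds : List Rule :=
  [firstPartial, secondPartial] ++ quarticMonomials.map fun s => shift s firstMultiplier

/-- The elements of `colonBasis` that are derived from its seeds. -/
def colonDerivations : List Derivation :=
  [
    (((8, 4, 1, 1), [(-9, 5, 1, 0), (1, 1, 3, 2), (-5, 2, 3, 1), (6, 3, 3, 0), (-1, 1, 5, 0)]), 9,
      [(1, [(-4, 1, 0, 0)]), (0, [(-5, 0, 1, 0)])]),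
    (((192, 5, 0, 3), [(-1728, 6, 0, 2), (-144, 7, 0, 1), (2160, 8, 0, 0), (-496, 3, 2, 3), (-459,
      6, 2, 0), (-24, 1, 4, 3), (-117, 2, 4, 2), (449, 3, 4, 1), (162, 4, 4, 0), (320, 0, 6, 2),
      (-168, 1, 6, 1), (-275, 2, 6, 0), (64, 0, 8, 0)]), 1, [(2, [(64, 0, 0, 0)]), (0, [(128, 1,
      0, 2), (-16, 2, 0, 1), (240, 3, 0, 0), (48, 0, 2, 1), (16, 1, 2, 0)]), (1, [(64, 0, 1, 2),
      (64, 0, 3, 0)]), (17, [(216, 0, 1, 1), (-93, 1, 1, 0)])]),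
    (((1800, 7, 1, 0), [(-35392, 2, 3, 3), (632, 3, 3, 2), (39813, 5, 3, 0), (20480, 0, 5, 3),
      (-16845, 1, 5, 2), (3905, 2, 5, 1), (-27142, 3, 5, 0), (4096, 0, 7, 1), (4557, 1, 7, 0)]),
      1, [(3, [(4096, 0, 0, 0)]), (0, [(8192, 1, 1, 1), (-1024, 2, 1, 0), (1152, 0, 3, 0)]), (17,
      [(7680, 0, 0, 2), (7104, 1, 0, 1), (-1224, 2, 0, 0), (-3405, 0, 2, 0)]), (1, [(4096, 0, 2,
      1)])]),
    (((64, 3, 2, 3), [(-63, 6, 2, 0), (-72, 1, 4, 3), (-529, 2, 4, 2), (45, 3, 4, 1), (618, 4, 4,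
      0), (320, 0, 6, 2), (-120, 1, 6, 1), (-391, 2, 6, 0), (64, 0, 8, 0)]), 1, [(4, [(64, 0, 0,
      0)]), (0, [(128, 1, 2, 0)]), (17, [(120, 0, 1, 1), (135, 1, 1, 0)]), (1, [(64, 0, 3, 0)])]),
    (((-64, 2, 3, 3), [(8, 3, 3, 2), (81, 5, 3, 0), (40, 0, 5, 3), (-33, 1, 5, 2), (-3, 2, 5, 1),
      (-54, 3, 5, 0), (8, 0, 7, 1), (9, 1, 7, 0)]), 1, [(5, [(8, 0, 0, 0)]), (17, [(-9, 0, 2,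
      0)])]),
    (((-8, 2, 4, 2), [(1, 3, 4, 1), (9, 4, 4, 0), (5, 0, 6, 2), (-3, 1, 6, 1), (-6, 2, 6, 0), (1,
      0, 8, 0)]), 1, [(6, [(1, 0, 0, 0)])]),
    (((-67584, 6, 0, 2), [(3456, 7, 0, 1), (85248, 8, 0, 0), (-42216, 6, 2, 0), (-20800, 1, 4, 3),
      (10133, 3, 4, 1), (7477, 4, 4, 0), (4305, 0, 6, 2), (21289, 1, 6, 1), (-3542, 2, 6, 0),
      (861, 0, 8, 0)]), 1, [(7, [(512, 0, 0, 0)]), (0, [(1024, 2, 0, 1), (-128, 3, 0, 0), (-640,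
      0, 2, 1), (384, 1, 2, 0)]), (18, [(40, 0, 0, 0)]), (20, [(318, 0, 0, 0)]), (17, [(-656, 0,
      1, 1), (894, 1, 1, 0)]), (22, [(-22051, 0, 0, 0)])]),
    (((-64, 3, 3, 2), [(81, 5, 3, 0), (39, 1, 5, 2), (-19, 2, 5, 1), (-54, 3, 5, 0), (9, 1, 7,
      0)]), 512, [(8, [(4096, 0, 0, 0)]), (0, [(8192, 2, 1, 0), (-4992, 0, 3, 0)]), (17, [(-512,
      0, 0, 2), (7104, 1, 0, 1), (7992, 2, 0, 0), (-9549, 0, 2, 0)]), (19, [(-1, 0, 0, 0)]), (21,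
      [(512, 0, 0, 0)])]),
    (((1800, 6, 2, 0), [(-2112, 1, 4, 3), (-1801, 3, 4, 1), (-4521, 4, 4, 0), (-1845, 0, 6, 2),
      (6291, 1, 6, 1), (2414, 2, 6, 0), (-369, 0, 8, 0)]), 1, [(9, [(512, 0, 0, 0)]), (20, [(64,
      0, 0, 0)]), (17, [(-64, 0, 1, 1), (-648, 1, 1, 0)]), (22, [(-4465, 0, 0, 0)])]),
    (((23400, 7, 0, 1), [(-43200, 8, 0, 0), (176568, 1, 4, 3), (-64661, 3, 4, 1), (260019, 4, 4,
      0), (136455, 0, 6, 2), (-404649, 1, 6, 1), (-166946, 2, 6, 0), (27291, 0, 8, 0)]), 32, [(11,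
      [(1689600, 0, 0, 0)]), (0, [(3379200, 3, 0, 0), (-2112000, 1, 2, 0)]), (18, [(-8800, 0, 0,
      0)]), (23, [(-150, 0, 0, 0)]), (20, [(11000, 0, 0, 0)]), (17, [(211200, 0, 1, 1), (-3564000,
      1, 1, 0)]), (25, [(-1373, 0, 0, 0)]), (22, [(355025, 0, 0, 0)])]),
    (((225, 5, 3, 0), [(320, 0, 5, 3), (215, 1, 5, 2), (-1347, 2, 5, 1), (-150, 3, 5, 0), (64, 0,
      7, 1), (25, 1, 7, 0)]), 1, [(12, [(512, 0, 0, 0)]), (17, [(512, 0, 0, 2), (512, 1, 0, 1)]),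
      (0, [(-128, 0, 3, 0)]), (21, [(8, 0, 0, 0)]), (24, [(9, 0, 0, 0)])]),
    (((8, 1, 4, 3), [(-15, 3, 4, 1), (9, 4, 4, 0), (5, 0, 6, 2), (-11, 1, 6, 1), (-6, 2, 6, 0),
      (1, 0, 8, 0)]), 1, [(13, [(8, 0, 0, 0)]), (17, [(8, 0, 1, 1), (8, 1, 1, 0)]), (22, [(1, 0,
      0, 0)])]),
    (((-67500, 8, 0, 0), [(1042411, 3, 4, 1), (184095, 4, 4, 0), (89775, 0, 6, 2), (-605937, 1, 6,
      1), (-112730, 2, 6, 0), (17955, 0, 8, 0)]), 704, [(14, [(65894400, 0, 0, 0)]), (18,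
      [(2745600, 0, 0, 0)]), (23, [(-69225, 0, 0, 0)]), (26, [(1776, 0, 0, 0)]), (20, [(16130400,
      0, 0, 0)]), (17, [(24710400, 0, 1, 1), (77220000, 1, 1, 0)]), (25, [(27235, 0, 0, 0)]), (28,
      [(-61671456, 0, 0, 0)]), (22, [(-1112568600, 0, 0, 0)])])]

/-- Rules for an ideal of elements that multiply the third partial derivative of `g` into the ideal
of the other two. -/
def colonBasis : List Rule := colonSeeds ++ colonDerivations.map Prod.fst

lemma isDerivationChain_jacobian : isDerivationChain jacobianSeeds jacobianDerivations = true := by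
  decide +kernel

lemma isDerivationChain_colon : isDerivationChain colonSeeds colonDerivations = true := by
  decide +kernel

lemma jacobianBasis_isAdmissible : ∀ G ∈ jacobianBasis, IsAdmissible G := by decide +kernel

lemma colonBasis_isAdmissible : ∀ G ∈ colonBasis, IsAdmissible G := by decide +kernel

lemma firstPartial_isAdmissible : IsAdmissible firstPartial := by decide +kernel

lemma card_standardMonomials_jacobianBasis :
    (standardMonomials jacobianBasis 14).card = 137 := by
  decide +kernel

lemma deg_ne_of_standard (e : Exponent)
    (h : ∀ G ∈ jacobianBasis, ¬ G.1.2 ≤ e) : deg e ≠ 14 := by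
  have key : ∀ e ∈ standardMonomials jacobianBasis 15, deg e ≠ 14 := by decide +kernel
  intro he
  exact key e (mem_standardMonomials.2 ⟨by omega, h⟩) he

lemma card_standardMonomials_colonBasis : (standardMonomials colonBasis 9).card = 113 := by
  decide +kernel

lemma card_standardMonomials_firstPartial :
    (standardMonomials [firstPartial] 9).card = 145 := by
  decide +kernel

lemma card_standardMonomials_nil_nine : (standardMonomials [] 9).card = 165 := by
  decide +kernel

lemma card_standardMonomials_nil_fourteen : (standardMonomials [] 14).card = 560 := by
  decide +kernel

section Ideals

variable {R : Type*} [CommRing R] (u v z : R)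

/-- The third partial derivative of `g`, up to a constant factor. -/
def lastGenerator : R := 2 * evalSparse u v z (terms thirdPartial) + 63 * z ^ 6

/-- The ideal generated by the partial derivatives of `g`. -/
def jacobianIdeal : Ideal R :=
  Ideal.span {evalSparse u v z (terms firstPartial), evalSparse u v z (terms secondPartial),
    lastGenerator u v z}

/-- An ideal of elements that multiply the third partial derivative of `g` into the ideal of the
other two, up to elements of high order. -/
def colonIdeal : Ideal R :=
  Ideal.span {evalSparse u v z (terms firstPartial), evalSparse u v z (terms secondPartial)} ⊔
    (Ideal.span {evalSparse u v z (terms firstMultiplier)} * idealOf u v z ^ 4 ⊔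
      idealOf u v z ^ 9)

lemma syzygy_of_isZero {s t p : Sparse}
    (h : IsZero (mulSparse s (terms firstPartial) ++ (mulSparse t (terms secondPartial) ++
      mulSparse p (terms thirdPartial)))) :
    evalSparse u v z p * evalSparse u v z (terms thirdPartial) =
      -(evalSparse u v z s * evalSparse u v z (terms firstPartial) +
        evalSparse u v z t * evalSparse u v z (terms secondPartial)) := by
  have := evalSparse_eq_zero u v z h
  simp only [evalSparse_append, evalSparse_mulSparse] at this
  linear_combination this

lemma syzygy_first :
    evalSparse u v z (terms firstMultiplier) * evalSparse u v z (terms thirdPartial) =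
      -(evalSparse u v z firstSyzygyLeft * evalSparse u v z (terms firstPartial) +
        evalSparse u v z firstSyzygyRight * evalSparse u v z (terms secondPartial)) :=
  syzygy_of_isZero u v z (by decide +kernel)

lemma syzygy_second :
    evalSparse u v z (terms secondMultiplier) * evalSparse u v z (terms thirdPartial) =
      -(evalSparse u v z secondSyzygyLeft * evalSparse u v z (terms firstPartial) +
        evalSparse u v z secondSyzygyRight * evalSparse u v z (terms secondPartial)) :=
  syzygy_of_isZero u v z (by decide +kernel)

lemma firstPartial_mem : evalSparse u v z (terms firstPartial) ∈ idealOf u v z ^ 5 :=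
  evalSparse_mem u v z (by decide +kernel)

lemma secondPartial_mem : evalSparse u v z (terms secondPartial) ∈ idealOf u v z ^ 5 :=
  evalSparse_mem u v z (by decide +kernel)

lemma pow_six_mem : z ^ 6 ∈ idealOf u v z ^ 6 := by
  simpa [monom, deg] using monom_mem u v z (0, 0, 6)

lemma lastGenerator_mem : lastGenerator u v z ∈ idealOf u v z ^ 5 := by
  refine add_mem (Ideal.mul_mem_left _ _ (evalSparse_mem u v z (by decide +kernel)))
    (Ideal.mul_mem_left _ _ ?_)
  exact Ideal.pow_le_pow_right (by norm_num) (pow_six_mem u v z)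

lemma lastGenerator_mul_mem {x : R} (hx : x ∈ colonIdeal u v z) :
    lastGenerator u v z * x ∈ idealOf u v z ^ 14 ⊔
      Ideal.span {evalSparse u v z (terms firstPartial)} ⊔
      Ideal.span {evalSparse u v z (terms secondPartial)} := by
  rw [sup_assoc, ← Ideal.span_union, Set.singleton_union]
  obtain ⟨a, ha, y, hy, rfl⟩ := Submodule.mem_sup.1 hx
  obtain ⟨b, hb, c, hc, rfl⟩ := Submodule.mem_sup.1 hy
  rw [mul_add, mul_add]
  refine add_mem (Submodule.mem_sup_right (Ideal.mul_mem_left _ _ ha)) (add_mem ?_ ?_)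
  · obtain ⟨s, hs, rfl⟩ := Ideal.mem_span_singleton_mul.1 hb
    have key : lastGenerator u v z * (evalSparse u v z (terms firstMultiplier) * s) =
        63 * (evalSparse u v z (terms firstMultiplier) * z ^ 6 * s) +
        (-(2 * s * evalSparse u v z firstSyzygyLeft) * evalSparse u v z (terms firstPartial) +
          -(2 * s * evalSparse u v z firstSyzygyRight) *
            evalSparse u v z (terms secondPartial)) := by
      rw [lastGenerator]
      linear_combination 2 * s * syzygy_first u v z
    rw [key]
    refine Submodule.add_mem_sup (Ideal.mul_mem_left _ _ ?_)
      (Ideal.mem_span_pair.2 ⟨_, _, rfl⟩)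
    have hα : evalSparse u v z (terms firstMultiplier) ∈ idealOf u v z ^ 4 :=
      evalSparse_mem u v z (by decide +kernel)
    have := Ideal.mul_mem_mul (Ideal.mul_mem_mul hα (pow_six_mem u v z)) hs
    rwa [← pow_add, ← pow_add] at this
  · refine Submodule.mem_sup_left ?_
    have := Ideal.mul_mem_mul (lastGenerator_mem u v z) hc
    rwa [← pow_add] at this

end Ideals

section Codimension

variable {R : Type*} [CommRing R] [Algebra ℂ R] {u v z : R}

lemma holds_jacobianBasis : ∀ G ∈ jacobianBasis, Holds u v z (jacobianIdeal u v z) G := by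
  have h₁ : evalSparse u v z (terms firstPartial) ∈ jacobianIdeal u v z :=
    Ideal.subset_span (by simp)
  have h₂ : evalSparse u v z (terms secondPartial) ∈ jacobianIdeal u v z :=
    Ideal.subset_span (by simp)
  have h₃ : lastGenerator u v z ∈ jacobianIdeal u v z := Ideal.subset_span (by simp)
  have hmul : ∀ {p a b : R}, p * evalSparse u v z (terms thirdPartial) =
      -(a * evalSparse u v z (terms firstPartial) + b * evalSparse u v z (terms secondPartial)) →
      monom u v z (0, 0, 6) * p ∈ jacobianIdeal u v z := by
    intro p a b h
    refine mem_ideal_of_intCast_mul_mem 63 (by decide) (add_mem (Ideal.mul_mem_left _ p h₃)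
      (add_mem (Ideal.mul_mem_left _ (2 * a) h₁) (Ideal.mul_mem_left _ (2 * b) h₂))) ?_
    simp only [monom, lastGenerator]
    push_cast
    linear_combination -2 * h
  refine holds_of_isDerivationChain _ _ isDerivationChain_jacobian ?_
  simp only [jacobianSeeds, List.forall_mem_cons]
  refine ⟨Submodule.mem_sup_left h₁, Submodule.mem_sup_left h₂, ?_, ?_, ?_, by simp⟩
  · refine mem_ideal_of_intCast_mul_mem 2 (by decide) (Submodule.add_mem_sup h₃
      (Ideal.mul_mem_left _ (-63) (pow_six_mem u v z))) ?_
    rw [lastGenerator]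
    push_cast
    ring
  · rw [Holds, evalSparse_shift]
    exact Submodule.mem_sup_left (hmul (syzygy_first u v z))
  · rw [Holds, evalSparse_shift]
    exact Submodule.mem_sup_left (hmul (syzygy_second u v z))

lemma holds_colonBasis : ∀ G ∈ colonBasis, Holds u v z (colonIdeal u v z) G := by
  refine holds_of_isDerivationChain _ _ isDerivationChain_colon ?_
  refine List.forall_mem_append.2 ⟨?_, List.forall_mem_map.2 fun s hs => ?_⟩
  · simp only [List.forall_mem_cons]
    exact ⟨Submodule.mem_sup_left (Submodule.mem_sup_left (Ideal.subset_span (by simp))),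
      Submodule.mem_sup_left (Submodule.mem_sup_left (Ideal.subset_span (by simp))), by simp⟩
  · have hdeg : ∀ s ∈ quarticMonomials, deg s = 4 := by decide +kernel
    rw [Holds, evalSparse_shift, mul_comm]
    refine Submodule.mem_sup_left (Submodule.mem_sup_right (Submodule.mem_sup_left
      (Ideal.mul_mem_mul (Ideal.mem_span_singleton_self _) ?_)))
    rw [← hdeg s hs]
    exact monom_mem u v z s

variable (hR : ∀ r : R, ∃ c : ℂ, r - algebraMap ℂ R c ∈ idealOf u v z)
include hR

lemma pow_le_jacobianIdeal_sup :
    idealOf u v z ^ 14 ≤ jacobianIdeal u v z ⊔ idealOf u v z ^ 15 :=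
  pow_le_of_rules (W := (jacobianIdeal u v z ⊔ idealOf u v z ^ 15).restrictScalars ℂ) hR
    jacobianBasis_isAdmissible holds_jacobianBasis
    (fun _ hx => Ideal.mem_sup_left (S := jacobianIdeal u v z) hx)
    (fun _ hx => Ideal.mem_sup_right (S := jacobianIdeal u v z) hx)
    fun e he h => absurd he (deg_ne_of_standard e h)

/-- Up to multiplication by an element that is invertible at the origin, all elements of order at
least `14` lie in the ideal of partial derivatives. -/
lemma exists_mul_mem_jacobianIdeal :
    ∃ r : R, r - 1 ∈ idealOf u v z ∧
      ∀ x ∈ idealOf u v z ^ 14, r * x ∈ jacobianIdeal u v z := by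
  have hfg : (idealOf u v z ^ 14).FG :=
    Submodule.FG.pow (Submodule.fg_span (Set.toFinite {u, v, z})) 14
  obtain ⟨r, hr, h⟩ := Submodule.exists_sub_one_mem_and_smul_le_of_fg_of_le_sup
    (I := idealOf u v z) (N := jacobianIdeal u v z) hfg le_rfl (by
      have := pow_le_jacobianIdeal_sup hR
      rwa [pow_succ' _ 14] at this)
  exact ⟨r, hr, fun x hx => h (Submodule.smul_mem_pointwise_smul x r _ hx)⟩

lemma finrank_quotient_jacobianIdeal_le (h : idealOf u v z ^ 14 ≤ jacobianIdeal u v z) :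
    Module.finrank ℂ (R ⧸ jacobianIdeal u v z) ≤ 137 :=
  card_standardMonomials_jacobianBasis ▸
    (finrank_quotient_le hR jacobianBasis_isAdmissible holds_jacobianBasis h).2

lemma le_finrank_quotient_jacobianIdeal (h : idealOf u v z ^ 14 ≤ jacobianIdeal u v z)
    (hpow : 560 ≤ Module.finrank ℂ (R ⧸ idealOf u v z ^ 14)) :
    137 ≤ Module.finrank ℂ (R ⧸ jacobianIdeal u v z) := by
  set m := idealOf u v z with hm
  set f₁ := evalSparse u v z (terms firstPartial) with hf₁
  set f₂ := evalSparse u v z (terms secondPartial) with hf₂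
  have hfin : ∀ {I : Ideal R} {n : ℕ}, m ^ n ≤ I → Module.Finite ℂ (R ⧸ I) := fun hI =>
    (finrank_quotient_le (B := []) hR (by simp) (by simp) hI).1
  have hJ : m ^ 14 ⊔ Ideal.span {f₁} ⊔ Ideal.span {f₂} ⊔ Ideal.span {lastGenerator u v z} =
      jacobianIdeal u v z := by
    rw [sup_assoc, sup_assoc, ← Ideal.span_union, ← Ideal.span_union, Set.singleton_union,
      Set.singleton_union]
    exact sup_eq_right.2 h
  have := hfin (le_refl (m ^ 14))
  have := hfin (le_refl (m ^ 9))
  have := hfin (le_sup_left : m ^ 14 ≤ m ^ 14 ⊔ Ideal.span {f₁})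
  have := hfin (le_sup_right : m ^ 9 ≤ Ideal.span {f₁} ⊔ m ^ 9)
  have := hfin (le_sup_left.trans le_sup_left :
    m ^ 14 ≤ m ^ 14 ⊔ Ideal.span {f₁} ⊔ Ideal.span {f₂})
  have hK : m ^ 9 ≤ colonIdeal u v z := le_sup_right.trans le_sup_right
  have := hfin hK
  have hmul : ∀ {f x : R}, f ∈ m ^ 5 → x ∈ m ^ 9 → f * x ∈ m ^ 14 := fun hf hx => by
    have := Ideal.mul_mem_mul hf hx
    rwa [← pow_add] at this
  have h₁ := finrank_quotient_le_add (I := m ^ 14) (K := m ^ 9) f₁ fun x hx =>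
    hmul (firstPartial_mem u v z) hx
  have h₂ := finrank_quotient_le_add (I := m ^ 14 ⊔ Ideal.span {f₁})
    (K := Ideal.span {f₁} ⊔ m ^ 9) f₂ fun x hx => by
      obtain ⟨a, ha, b, hb, rfl⟩ := Submodule.mem_sup.1 hx
      rw [mul_add]
      exact add_mem (Submodule.mem_sup_right (Ideal.mul_mem_left _ _ ha))
        (Submodule.mem_sup_left (hmul (secondPartial_mem u v z) hb))
  have h₃ := finrank_quotient_le_add (I := m ^ 14 ⊔ Ideal.span {f₁} ⊔ Ideal.span {f₂})
    (K := colonIdeal u v z) (lastGenerator u v z) fun x hx => lastGenerator_mul_mem u v z hx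
  have hd₁ : Module.finrank ℂ (R ⧸ m ^ 9) ≤ 165 :=
    card_standardMonomials_nil_nine ▸
      (finrank_quotient_le (B := []) hR (by simp) (by simp) le_rfl).2
  have hd₂ : Module.finrank ℂ (R ⧸ (Ideal.span {f₁} ⊔ m ^ 9)) ≤ 145 :=
    card_standardMonomials_firstPartial ▸
      (finrank_quotient_le (B := [firstPartial]) hR (by simpa using firstPartial_isAdmissible)
        (List.forall_mem_singleton.2 (Submodule.mem_sup_left (Submodule.mem_sup_left
          (Ideal.mem_span_singleton_self _)))) le_sup_right).2
  have hd₃ : Module.finrank ℂ (R ⧸ colonIdeal u v z) ≤ 113 :=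
    card_standardMonomials_colonBasis ▸
      (finrank_quotient_le hR colonBasis_isAdmissible holds_colonBasis hK).2
  rw [hJ] at h₃
  omega

end Codimension

section Polynomial

/-- The first of the coordinates `x + z / 2`, `y + 2 z`, `z` adapted to the sextic. -/
noncomputable def firstCoordinate : MvPolynomial (Fin 3) ℂ := X 0 + C (1 / 2) * X 2

/-- The second of the coordinates `x + z / 2`, `y + 2 z`, `z` adapted to the sextic. -/
noncomputable def secondCoordinate : MvPolynomial (Fin 3) ℂ := X 1 + C 2 * X 2

/-- The value of a polynomial at the adapted coordinates. -/
noncomputable abbrev evalCoordinates (p : Sparse) : MvPolynomial (Fin 3) ℂ :=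
  evalSparse firstCoordinate secondCoordinate (X 2) p

lemma pderiv_zero : pderiv 0 (g6 + X 2 ^ 7) =
    C (2 / 3) * evalCoordinates (terms firstPartial) := by
  have h20 : (2 : Fin 3) ≠ 0 := by decide
  have h10 : (1 : Fin 3) ≠ 0 := by decide
  refine MvPolynomial.funext fun p => ?_
  simp only [g6, firstCoordinate, secondCoordinate, map_add, map_sub, Derivation.leibniz,
    Derivation.leibniz_pow, pderiv_X_self, pderiv_X_of_ne h20, pderiv_X_of_ne h10, pderiv_C,
    map_evalSparse, map_mul, map_pow, eval_X, eval_C, smul_eq_mul, nsmul_eq_mul, map_natCast,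
    map_one, map_zero]
  simp only [evalSparse, terms, firstPartial, monom, List.map_cons, List.map_nil, List.sum_cons,
    List.sum_nil]
  push_cast
  ring

lemma pderiv_one : pderiv 1 (g6 + X 2 ^ 7) =
    C (-2 / 9) * evalCoordinates (terms secondPartial) := by
  have h21 : (2 : Fin 3) ≠ 1 := by decide
  have h01 : (0 : Fin 3) ≠ 1 := by decide
  refine MvPolynomial.funext fun p => ?_
  simp only [g6, firstCoordinate, secondCoordinate, map_add, map_sub, Derivation.leibniz,
    Derivation.leibniz_pow, pderiv_X_self, pderiv_X_of_ne h21, pderiv_X_of_ne h01, pderiv_C,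
    map_evalSparse, map_mul, map_pow, eval_X, eval_C, smul_eq_mul, nsmul_eq_mul, map_natCast,
    map_one, map_zero]
  simp only [evalSparse, terms, secondPartial, monom, List.map_cons, List.map_nil, List.sum_cons,
    List.sum_nil]
  push_cast
  ring

lemma pderiv_two : pderiv 2 (g6 + X 2 ^ 7) =
    C (1 / 3) * evalCoordinates (terms firstPartial) +
      C (-4 / 9) * evalCoordinates (terms secondPartial) +
      C (1 / 9) * lastGenerator firstCoordinate secondCoordinate (X 2) := by
  have h02 : (0 : Fin 3) ≠ 2 := by decide
  have h12 : (1 : Fin 3) ≠ 2 := by decide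
  refine MvPolynomial.funext fun p => ?_
  simp only [g6, lastGenerator, firstCoordinate, secondCoordinate, map_add, map_sub,
    Derivation.leibniz, Derivation.leibniz_pow, pderiv_X_self, pderiv_X_of_ne h02,
    pderiv_X_of_ne h12, pderiv_C, map_evalSparse, map_mul, map_pow, eval_X, eval_C, smul_eq_mul,
    nsmul_eq_mul, map_natCast, map_one, map_zero]
  simp only [evalSparse, terms, firstPartial, secondPartial, thirdPartial, monom, map_ofNat,
    List.map_cons, List.map_nil, List.sum_cons, List.sum_nil]
  push_cast
  ring

lemma span_pderiv : Ideal.span (Set.range fun i => pderiv i (g6 + X 2 ^ 7)) =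
    jacobianIdeal firstCoordinate secondCoordinate (X 2) := by
  have hC : ∀ {a b : ℂ}, a * b = 1 → ∀ x : MvPolynomial (Fin 3) ℂ, C a * (C b * x) = x := by
    intro a b hab x
    rw [← mul_assoc, ← C_mul, hab, C_1, one_mul]
  apply le_antisymm
  · rw [Ideal.span_le]
    have h₁ : evalCoordinates (terms firstPartial) ∈
        jacobianIdeal firstCoordinate secondCoordinate (X 2) := Ideal.subset_span (by simp)
    have h₂ : evalCoordinates (terms secondPartial) ∈
        jacobianIdeal firstCoordinate secondCoordinate (X 2) := Ideal.subset_span (by simp)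
    have h₃ : lastGenerator firstCoordinate secondCoordinate (X 2) ∈
        jacobianIdeal firstCoordinate secondCoordinate (X 2) := Ideal.subset_span (by simp)
    rintro _ ⟨i, rfl⟩
    revert i
    simp only [Fin.forall_fin_succ, SetLike.mem_coe]
    refine ⟨?_, ?_, ?_, fun i => i.elim0⟩
    · exact pderiv_zero ▸ Ideal.mul_mem_left _ _ h₁
    · exact pderiv_one ▸ Ideal.mul_mem_left _ _ h₂
    · exact pderiv_two ▸ add_mem (add_mem (Ideal.mul_mem_left _ _ h₁)
        (Ideal.mul_mem_left _ _ h₂)) (Ideal.mul_mem_left _ _ h₃)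
  · set J := Ideal.span (Set.range fun i => pderiv i (g6 + X 2 ^ 7)) with hJ
    have hmem : ∀ i, pderiv i (g6 + X 2 ^ 7) ∈ J := fun i => Ideal.subset_span ⟨i, rfl⟩
    have h₁ : evalCoordinates (terms firstPartial) ∈ J := by
      rw [← hC (show (3 / 2 : ℂ) * (2 / 3) = 1 by norm_num) (evalCoordinates _), ← pderiv_zero]
      exact Ideal.mul_mem_left _ _ (hmem 0)
    have h₂ : evalCoordinates (terms secondPartial) ∈ J := by
      rw [← hC (show (-9 / 2 : ℂ) * (-2 / 9) = 1 by norm_num) (evalCoordinates _), ← pderiv_one]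
      exact Ideal.mul_mem_left _ _ (hmem 1)
    have h₃ : lastGenerator firstCoordinate secondCoordinate (X 2) ∈ J := by
      rw [← hC (show (9 : ℂ) * (1 / 9) = 1 by norm_num) (lastGenerator _ _ _)]
      refine Ideal.mul_mem_left _ _ ((Ideal.add_mem_iff_right _ ?_).1 (pderiv_two ▸ hmem 2))
      exact add_mem (Ideal.mul_mem_left _ _ h₁) (Ideal.mul_mem_left _ _ h₂)
    rw [jacobianIdeal, Ideal.span_le]
    rintro x (rfl | rfl | rfl)
    exacts [h₁, h₂, h₃]

lemma X_mem_idealOf (i : Fin 3) :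
    (X i : MvPolynomial (Fin 3) ℂ) ∈ idealOf firstCoordinate secondCoordinate (X 2) := by
  have h₂ : (X 2 : MvPolynomial (Fin 3) ℂ) ∈ idealOf firstCoordinate secondCoordinate (X 2) :=
    Ideal.subset_span (by simp)
  fin_cases i
  · refine (Ideal.add_mem_iff_left _ (Ideal.mul_mem_left _ (C (1 / 2)) h₂)).1 ?_
    exact Ideal.subset_span (by simp [firstCoordinate])
  · refine (Ideal.add_mem_iff_left _ (Ideal.mul_mem_left _ (C 2) h₂)).1 ?_
    exact Ideal.subset_span (by simp [secondCoordinate])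
  · exact h₂

lemma exists_sub_algebraMap_mem (r : MvPolynomial (Fin 3) ℂ) :
    ∃ c : ℂ, r - algebraMap ℂ (MvPolynomial (Fin 3) ℂ) c ∈
      idealOf firstCoordinate secondCoordinate (X 2) := by
  induction r using MvPolynomial.induction_on with
  | C a => exact ⟨a, by simp [algebraMap_eq]⟩
  | add p q hp hq =>
    obtain ⟨a, ha⟩ := hp
    obtain ⟨b, hb⟩ := hq
    refine ⟨a + b, ?_⟩
    rw [map_add, add_sub_add_comm]
    exact add_mem ha hb
  | mul_X p i _ =>
    refine ⟨0, ?_⟩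
    rw [map_zero, sub_zero]
    exact Ideal.mul_mem_left _ _ (X_mem_idealOf i)

lemma hasIsolatedCriticalPointAtOrigin : HasIsolatedCriticalPointAtOrigin (g6 + X 2 ^ 7) := by
  have heval : ∀ {p : Fin 3 → ℂ} {I : Ideal (MvPolynomial (Fin 3) ℂ)} {S : Set _},
      I = Ideal.span S → (∀ s ∈ S, eval p s = 0) → ∀ f ∈ I, eval p f = 0 := by
    rintro p _ S rfl hS f hf
    exact (Ideal.span_le (I := RingHom.ker (eval p))).2 hS hf
  have hm : ∀ f ∈ idealOf firstCoordinate secondCoordinate (X 2), eval 0 f = 0 :=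
    heval rfl (by simp [firstCoordinate, secondCoordinate])
  refine ⟨fun i => hm _ ?_, ?_⟩
  · have hJ : jacobianIdeal firstCoordinate secondCoordinate (X 2) ≤
        idealOf firstCoordinate secondCoordinate (X 2) := by
      rw [jacobianIdeal, Ideal.span_le]
      rintro x (rfl | rfl | rfl)
      exacts [Ideal.pow_le_self (by norm_num) (firstPartial_mem _ _ _),
        Ideal.pow_le_self (by norm_num) (secondPartial_mem _ _ _),
        Ideal.pow_le_self (by norm_num) (lastGenerator_mem _ _ _)]
    exact hJ (span_pderiv ▸ Ideal.subset_span ⟨i, rfl⟩)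
  · obtain ⟨r, hr, h⟩ := exists_mul_mem_jacobianIdeal exists_sub_algebraMap_mem
    have hr0 : eval 0 r ≠ 0 := by
      have := hm _ hr
      rw [map_sub, map_one, sub_eq_zero] at this
      rw [this]
      exact one_ne_zero
    obtain ⟨ε, hε, hball⟩ := Metric.eventually_nhds_iff.1
      ((MvPolynomial.continuous_eval r).continuousAt.eventually_ne hr0)
    refine ⟨ε, hε, fun p hp hcrit => _root_.funext fun i => ?_⟩
    have hx := heval span_pderiv.symm (p := p) (by rintro _ ⟨i, rfl⟩; exact hcrit i) _
      (h _ (Ideal.pow_mem_pow (X_mem_idealOf i) 14))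
    rw [map_mul, map_pow, eval_X] at hx
    exact eq_zero_of_pow_eq_zero
      ((mul_eq_zero.1 hx).resolve_left (hball (by rwa [dist_zero_right])))

end Polynomial

section PowerSeries

/-- The ideal generated by the coordinates consists of the power series without constant term. -/
lemma mem_idealOf_X_iff {f : MvPowerSeries (Fin 3) ℂ} :
    f ∈ idealOf (MvPowerSeries.X 0) (MvPowerSeries.X 1) (MvPowerSeries.X 2) ↔
      MvPowerSeries.constantCoeff f = 0 := by
  constructor
  · refine fun hf => (Ideal.span_le (I := RingHom.ker MvPowerSeries.constantCoeff)).2 ?_ hf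
    rintro x (rfl | rfl | rfl) <;> exact MvPowerSeries.constantCoeff_X _
  · intro hf
    let a : MvPowerSeries (Fin 3) ℂ := fun d => if d 0 = 0 then 0 else MvPowerSeries.coeff d f
    let b : MvPowerSeries (Fin 3) ℂ := fun d =>
      if d 0 = 0 then if d 1 = 0 then 0 else MvPowerSeries.coeff d f else 0
    have ha : MvPowerSeries.X 0 ∣ a := MvPowerSeries.X_dvd_iff.2 fun d hd => if_pos hd
    have hb : MvPowerSeries.X 1 ∣ b := MvPowerSeries.X_dvd_iff.2 fun d hd => by
      change (if d 0 = 0 then if d 1 = 0 then 0 else MvPowerSeries.coeff d f else 0) = 0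
      rw [if_pos hd, ite_self]
    have hc : MvPowerSeries.X 2 ∣ f - a - b := MvPowerSeries.X_dvd_iff.2 fun d hd => by
      change MvPowerSeries.coeff d f - (if d 0 = 0 then 0 else MvPowerSeries.coeff d f) -
        (if d 0 = 0 then if d 1 = 0 then 0 else MvPowerSeries.coeff d f else 0) = 0
      split_ifs with h0 h1
      · have : d = 0 := by ext i; fin_cases i <;> assumption
        rw [this, MvPowerSeries.coeff_zero_eq_constantCoeff_apply, hf]
        simp
      all_goals simp
    have : f = a + b + (f - a - b) := by ring
    rw [this]
    refine add_mem (add_mem (Ideal.mem_of_dvd _ ha ?_) (Ideal.mem_of_dvd _ hb ?_))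
      (Ideal.mem_of_dvd _ hc ?_) <;> exact Ideal.subset_span (by simp)

local notation "𝓤" => (firstCoordinate : MvPowerSeries (Fin 3) ℂ)
local notation "𝓥" => (secondCoordinate : MvPowerSeries (Fin 3) ℂ)
local notation "𝓩" => ((X 2 : MvPolynomial (Fin 3) ℂ) : MvPowerSeries (Fin 3) ℂ)

lemma mem_maximalIdeal_iff {f : MvPowerSeries (Fin 3) ℂ} :
    f ∈ idealOf 𝓤 𝓥 𝓩 ↔ MvPowerSeries.constantCoeff f = 0 := by
  rw [← mem_idealOf_X_iff]
  have hmap := map_idealOf firstCoordinate secondCoordinate (X 2)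
    (coeToMvPowerSeries.ringHom (σ := Fin 3) (R := ℂ))
  simp only [coeToMvPowerSeries.ringHom_apply] at hmap
  refine ⟨fun hf => ?_, fun hf => ?_⟩
  · refine (Ideal.span_le (s := {𝓤, 𝓥, 𝓩})).2 ?_ hf
    rintro x (rfl | rfl | rfl) <;> refine mem_idealOf_X_iff.2 ?_ <;>
      simp [firstCoordinate, secondCoordinate]
  · refine (Ideal.span_le (s := {MvPowerSeries.X 0, MvPowerSeries.X 1, MvPowerSeries.X 2})).2 ?_ hf
    rw [← hmap]
    rintro x (rfl | rfl | rfl) <;> rw [← coe_X, ← coeToMvPowerSeries.ringHom_apply] <;>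
      exact Ideal.mem_map_of_mem _ (X_mem_idealOf _)

lemma exists_sub_algebraMap_mem_maximalIdeal (f : MvPowerSeries (Fin 3) ℂ) :
    ∃ c : ℂ, f - algebraMap ℂ (MvPowerSeries (Fin 3) ℂ) c ∈ idealOf 𝓤 𝓥 𝓩 := by
  refine ⟨MvPowerSeries.constantCoeff f, mem_maximalIdeal_iff.2 ?_⟩
  simp [MvPowerSeries.algebraMap_apply]

lemma pow_le_jacobianIdeal : idealOf 𝓤 𝓥 𝓩 ^ 14 ≤ jacobianIdeal 𝓤 𝓥 𝓩 := by
  obtain ⟨r, hr, h⟩ := exists_mul_mem_jacobianIdeal exists_sub_algebraMap_mem_maximalIdeal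
  have hunit : IsUnit r := by
    rw [mem_maximalIdeal_iff, map_sub, map_one, sub_eq_zero] at hr
    rw [MvPowerSeries.isUnit_iff_constantCoeff, hr]
    exact isUnit_one
  exact fun x hx => (Ideal.unit_mul_mem_iff_mem _ hunit).1 (h x hx)

lemma le_order_of_mem_pow {f : MvPowerSeries (Fin 3) ℂ} {n : ℕ}
    (hf : f ∈ idealOf 𝓤 𝓥 𝓩 ^ n) : (n : ℕ∞) ≤ f.order := by
  induction n generalizing f with
  | zero => simp
  | succ n ih =>
    rw [pow_succ] at hf
    refine Submodule.mul_induction_on hf (fun x hx y hy => ?_) fun x y hx hy =>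
      (le_min hx hy).trans MvPowerSeries.min_order_le_add
    rw [Nat.cast_add, Nat.cast_one]
    exact (add_le_add (ih hx) (MvPowerSeries.one_le_order_iff_constCoeff_eq_zero.2
      (mem_maximalIdeal_iff.1 hy))).trans MvPowerSeries.le_order_mul

/-- An exponent as a finitely supported function. -/
noncomputable def Exponent.toFinsupp (e : Exponent) : Fin 3 →₀ ℕ :=
  Finsupp.equivFunOnFinite.symm ![e.1, e.2.1, e.2.2]

lemma Exponent.toFinsupp_injective : Function.Injective Exponent.toFinsupp := by
  intro e f h
  have h := Finsupp.equivFunOnFinite.symm.injective h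
  exact Prod.ext (congrFun h 0) (Prod.ext (congrFun h 1) (congrFun h 2))

lemma Exponent.degree_toFinsupp (e : Exponent) : e.toFinsupp.degree = deg e := by
  simp [Finsupp.degree_eq_sum, Exponent.toFinsupp, Fin.sum_univ_three, deg]

lemma card_le_finrank_quotient_pow (n : ℕ) :
    (standardMonomials [] n).card ≤
      Module.finrank ℂ (MvPowerSeries (Fin 3) ℂ ⧸ idealOf 𝓤 𝓥 𝓩 ^ n) := by
  have := (finrank_quotient_le (B := []) exists_sub_algebraMap_mem_maximalIdeal (by simp) (by simp)
    (le_refl (idealOf 𝓤 𝓥 𝓩 ^ n))).1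
  let φ : MvPowerSeries (Fin 3) ℂ →ₗ[ℂ] (standardMonomials [] n → ℂ) :=
    LinearMap.pi fun e => MvPowerSeries.coeff e.1.toFinsupp
  have hφ : (idealOf 𝓤 𝓥 𝓩 ^ n).restrictScalars ℂ ≤ LinearMap.ker φ := by
    refine fun f hf => _root_.funext fun e => MvPowerSeries.coeff_of_lt_order ?_
    refine lt_of_lt_of_le ?_ (le_order_of_mem_pow hf)
    rw [Exponent.degree_toFinsupp]
    exact_mod_cast (mem_standardMonomials.1 e.2).1
  have hsurj : Function.Surjective φ := by
    intro a
    refine ⟨fun d => if h : ∃ e : standardMonomials [] n, e.1.toFinsupp = d then a h.choose else 0,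
      _root_.funext fun e => ?_⟩
    have h : ∃ e' : standardMonomials [] n, e'.1.toFinsupp = e.1.toFinsupp := ⟨e, rfl⟩
    refine (dif_pos h).trans (congrArg a (Subtype.ext ?_))
    exact Exponent.toFinsupp_injective h.choose_spec
  let ψ : (MvPowerSeries (Fin 3) ℂ ⧸ idealOf 𝓤 𝓥 𝓩 ^ n) →ₗ[ℂ] (standardMonomials [] n → ℂ) :=
    ((idealOf 𝓤 𝓥 𝓩 ^ n).restrictScalars ℂ).liftQ φ hφ
  have hψ : Function.Surjective ψ := fun a => by
    obtain ⟨f, rfl⟩ := hsurj a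
    exact ⟨Ideal.Quotient.mk _ f, rfl⟩
  have := LinearMap.finrank_le_finrank_of_surjective hψ
  rwa [Module.finrank_fintype_fun_eq_card, Fintype.card_coe] at this

lemma span_toMvPowerSeries_pderiv :
    Ideal.span (Set.range fun i => (pderiv i (g6 + X 2 ^ 7)).toMvPowerSeries) =
      jacobianIdeal 𝓤 𝓥 𝓩 := by
  have h := congrArg (Ideal.map (coeToMvPowerSeries.ringHom (σ := Fin 3) (R := ℂ))) span_pderiv
  rw [Ideal.map_span, ← Set.range_comp, jacobianIdeal, Ideal.map_span, Set.image_insert_eq,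
    Set.image_pair, lastGenerator, map_add, map_mul, map_mul, map_pow, map_ofNat, map_ofNat,
    map_evalSparse, map_evalSparse, map_evalSparse] at h
  exact h

lemma milnorNumber_eq : milnorNumber (g6 + X 2 ^ 7) = 137 := by
  rw [milnorNumber, span_toMvPowerSeries_pderiv]
  refine le_antisymm (finrank_quotient_jacobianIdeal_le exists_sub_algebraMap_mem_maximalIdeal
    pow_le_jacobianIdeal) (le_finrank_quotient_jacobianIdeal
      exists_sub_algebraMap_mem_maximalIdeal pow_le_jacobianIdeal ?_)
  exact card_standardMonomials_nil_fourteen ▸ card_le_finrank_quotient_pow 14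

end PowerSeries

end OkaSextic

/-- The polynomial `g = g₆ + z⁷` has an isolated critical point at the origin and Milnor number
`μ(g) = 137`. -/
theorem milnor_number_non_torus_sextic_isolation
    (g : MvPolynomial (Fin 3) ℂ) (hg : g = g6 + X 2 ^ 7) :
    HasIsolatedCriticalPointAtOrigin g ∧ milnorNumber g = 137 := by
  subst hg
  exact ⟨OkaSextic.hasIsolatedCriticalPointAtOrigin, OkaSextic.milnorNumber_eq⟩
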